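/- For β ∈ B₃, the matrix ρ₃(β) is a scalar matrix (i.e., ρ₃(β) = u·Id for some unit u of ℤ[t,t⁻¹]) if and only if β is an integer power of (σ₁σ₂)³. Consequently, the kernel of the projectivized Burau representation ρ̂₃ : B₃ → GL(2, ℤ[t,t⁻¹])/{±tⁿ·Id : n ∈ ℤ} is exactly the cyclic subgroup generated by (σ₁σ₂)³ (the center of B₃). -/

import Mathlib

open Matrix LaurentPolynomial
open scoped MatrixGroups

noncomputable section

/-- The braid relation σ₁σ₂σ₁ = σ₂σ₁σ₂ as a relator in the free group on two generators. -/
def braidRel : Set (FreeGroup (Fin 2)) :=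
  {FreeGroup.of 0 * FreeGroup.of 1 * FreeGroup.of 0 *
    (FreeGroup.of 1 * FreeGroup.of 0 * FreeGroup.of 1)⁻¹}

/-- The braid group B₃ on three strands. -/
abbrev B3 : Type := PresentedGroup braidRel

/-- The first Artin generator σ₁ of B₃. -/
def σ₁ : B3 := PresentedGroup.of 0

/-- The second Artin generator σ₂ of B₃. -/
def σ₂ : B3 := PresentedGroup.of 1
/-- The ring ℤ[t,t⁻¹] of integer Laurent polynomials. -/
abbrev Laur := LaurentPolynomial ℤ

section BraidPair

variable {G : Type*} [Group G] {a b : G}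

lemma commute_left_mul_pow_three (h : a * b * a = b * a * b) : Commute a ((a * b) ^ 3) := by
  have h1 : (a * b) ^ 3 = (a * b * a) * (a * b * a) := by
    rw [pow_succ, pow_two]
    calc a * b * (a * b) * (a * b) = a * b * a * (b * a * b) := by group
      _ = _ := by rw [h]
  calc a * (a * b) ^ 3 = a * (a * b * a) * (a * b * a) := by rw [h1]; group
    _ = a * (b * a * b) * (a * b * a) := by rw [h]
    _ = (a * b * a) * (b * a * b) * a := by group
    _ = (a * b * a) * (a * b * a) * a := by rw [h]
    _ = (a * b) ^ 3 * a := by rw [h1]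

lemma mul_mul_sq_eq_mul_pow_three (h : a * b * a = b * a * b) :
    (a * b * a) * (a * b * a) = (a * b) ^ 3 := by
  nth_rewrite 2 [h]
  rw [pow_succ, pow_two]
  group

lemma commute_right_mul_pow_three (h : a * b * a = b * a * b) : Commute b ((a * b) ^ 3) := by
  have h2 : Commute (a⁻¹ * (a * b)) ((a * b) ^ 3) :=
    ((commute_left_mul_pow_three h).inv_left).mul_left (Commute.self_pow _ _)
  simpa using h2

/-- The elements `z ^ k * u * w * v`, where `x = a * b * a`, `y = a * b`, `z = y ^ 3`,
`u ∈ {1, y, y⁻¹}`, `v ∈ {1, x}` and `w` is a positive word in `a⁻¹` and `b`. -/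
def HasBraidNormalForm (a b g : G) : Prop :=
  ∃ (k : ℤ) (u w v : G), (u = 1 ∨ u = a * b ∨ u = (a * b)⁻¹) ∧
    w ∈ Submonoid.closure {a⁻¹, b} ∧ (v = 1 ∨ v = a * b * a) ∧
    g = ((a * b) ^ 3) ^ k * (u * w * v)

namespace HasBraidNormalForm

lemma zpow_mul {g : G} (hg : HasBraidNormalForm a b g) (n : ℤ) :
    HasBraidNormalForm a b (((a * b) ^ 3) ^ n * g) := by
  obtain ⟨k, u, w, v, hu, hw, hv, rfl⟩ := hg
  exact ⟨n + k, u, w, v, hu, hw, hv, by rw [_root_.zpow_add, mul_assoc (_ ^ n)]⟩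

lemma mul_left_mul {g : G} (hg : HasBraidNormalForm a b g) :
    HasBraidNormalForm a b (a * b * g) := by
  obtain ⟨k, u, w, v, hu, hw, hv, rfl⟩ := hg
  have hc : Commute (a * b) (((a * b) ^ 3) ^ k) := (Commute.self_pow _ _).zpow_right _
  rw [← mul_assoc, hc.eq, mul_assoc]
  refine zpow_mul ?_ k
  rcases hu with rfl | rfl | rfl
  · exact ⟨0, a * b, w, v, by simp, hw, hv, by group⟩
  · exact ⟨1, (a * b)⁻¹, w, v, by simp, hw, hv, by simp only [pow_succ, pow_zero]; group⟩
  · exact ⟨0, 1, w, v, by simp, hw, hv, by group⟩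

lemma inv_mul_left_mul {g : G} (hg : HasBraidNormalForm a b g) :
    HasBraidNormalForm a b ((a * b)⁻¹ * g) := by
  have h := (hg.mul_left_mul.mul_left_mul).zpow_mul (-1)
  convert h using 1
  simp only [pow_succ, pow_zero]
  group

lemma mul_mul_left_mul (h : a * b * a = b * a * b) {g : G} (hg : HasBraidNormalForm a b g) :
    HasBraidNormalForm a b (a * b * a * g) := by
  obtain ⟨k, u, w, v, hu, hw, hv, rfl⟩ := hg
  have hx := mul_mul_sq_eq_mul_pow_three h
  have hc : Commute (a * b * a) (((a * b) ^ 3) ^ k) := by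
    rw [← hx]
    exact ((Commute.refl _).mul_right (Commute.refl _)).zpow_right _
  rw [← mul_assoc, hc.eq, mul_assoc]
  refine zpow_mul ?_ k
  rcases hu with rfl | rfl | rfl
  · induction hw using Submonoid.closure_induction_left with
    | one =>
      rcases hv with rfl | rfl
      · exact ⟨0, 1, 1, a * b * a, by simp, one_mem _, by simp, by group⟩
      · exact ⟨1, 1, 1, 1, by simp, one_mem _, by simp, by simp [hx]⟩
    | mul_left s hs w hw _ =>
      rcases hs with rfl | rfl
      · exact ⟨0, a * b, w, v, by simp, hw, hv, by group⟩
      · refine ⟨1, (a * s)⁻¹, w, v, by simp, hw, hv, ?_⟩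
        calc a * s * a * (1 * (s * w) * v) = (a * s) * (a * s) * (w * v) := by group
          _ = _ := by simp only [pow_succ, pow_zero]; group
  · refine ⟨1, 1, a⁻¹ * w, v, by simp,
      mul_mem (Submonoid.subset_closure (by simp)) hw, hv, ?_⟩
    rw [zpow_one, ← hx]
    group
  · refine ⟨0, 1, b * w, v, by simp, mul_mem (Submonoid.subset_closure (by simp)) hw, hv, ?_⟩
    rw [h]
    group

lemma of_closure_eq_top (h : a * b * a = b * a * b) (hab : Subgroup.closure {a, b} = ⊤) (g : G) :
    HasBraidNormalForm a b g := by
  have hx := mul_mul_sq_eq_mul_pow_three h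
  have hg : g ∈ Subgroup.closure {a, b} := by simp [hab]
  induction hg using Subgroup.closure_induction_left with
  | one => exact ⟨0, 1, 1, 1, by simp, one_mem _, by simp, by simp⟩
  | mul_left s hs g _ ih =>
    rcases hs with rfl | rfl
    · convert (ih.mul_mul_left_mul h).inv_mul_left_mul using 1
      group
    · convert ih.inv_mul_left_mul.mul_mul_left_mul h using 1
      rw [h]
      group
  | inv_mul_cancel s hs g _ ih =>
    rcases hs with rfl | rfl
    · convert (ih.mul_left_mul.mul_mul_left_mul h).zpow_mul (-1) using 1
      rw [← hx]
      group
    · convert ((ih.mul_mul_left_mul h).mul_left_mul).zpow_mul (-1) using 1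
      simp only [pow_succ, pow_zero]
      group

end HasBraidNormalForm

/-- Positive words in `a⁻¹` and `b` are sent to matrices with a checkerboard sign pattern. -/
lemma sign_pattern_of_mem_closure (φ : G →* GL (Fin 2) ℤ)
    (ha : (φ a : Matrix (Fin 2) (Fin 2) ℤ) = !![1, 1; 0, 1])
    (hb : (φ b : Matrix (Fin 2) (Fin 2) ℤ) = !![1, 0; -1, 1])
    {w : G} (hw : w ∈ Submonoid.closure {a⁻¹, b}) :
    ∃ p q r s : ℤ, (φ w : Matrix (Fin 2) (Fin 2) ℤ) = !![p, -q; -r, s] ∧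
      1 ≤ p ∧ 0 ≤ q ∧ 0 ≤ r ∧ 1 ≤ s ∧ (w = 1 ∨ 1 ≤ q + r) := by
  induction hw using Submonoid.closure_induction_left with
  | one => exact ⟨1, 0, 0, 1, by simp [Matrix.one_fin_two], by simp⟩
  | mul_left g hg w _ ih =>
    obtain ⟨p, q, r, s, hφ, hp, hq, hr, hs, -⟩ := ih
    rcases hg with rfl | rfl
    · have ha' : (φ a⁻¹ : Matrix (Fin 2) (Fin 2) ℤ) = !![1, -1; 0, 1] := by
        rw [map_inv, Matrix.coe_units_inv, ha, Matrix.inv_def]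
        simp [Matrix.adjugate_fin_two]
      refine ⟨p + r, q + s, r, s, ?_, by lia, by lia, by lia, by lia, .inr (by lia)⟩
      rw [map_mul, Units.val_mul, ha', hφ]
      ext i j; fin_cases i <;> fin_cases j <;> (simp; try ring)
    · refine ⟨p, q, p + r, q + s, ?_, by lia, by lia, by lia, by lia, .inr (by lia)⟩
      rw [map_mul, Units.val_mul, hb, hφ]
      ext i j; fin_cases i <;> fin_cases j <;> (simp; try ring)

/-- If `a` and `b` generate `G` and satisfy the braid relation, then only powers of `(a * b) ^ 3`
can become scalar under the standard action on `ℤ²`. -/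
lemma mem_zpowers_of_map_mem_range_scalar (h : a * b * a = b * a * b)
    (hab : Subgroup.closure {a, b} = ⊤) (φ : G →* GL (Fin 2) ℤ)
    (ha : (φ a : Matrix (Fin 2) (Fin 2) ℤ) = !![1, 1; 0, 1])
    (hb : (φ b : Matrix (Fin 2) (Fin 2) ℤ) = !![1, 0; -1, 1])
    {g : G} (hg : φ g ∈ (GeneralLinearGroup.scalar (R := ℤ) (Fin 2)).range) :
    g ∈ Subgroup.zpowers ((a * b) ^ 3) := by
  have hy : (φ (a * b) : Matrix (Fin 2) (Fin 2) ℤ) = !![0, 1; -1, 1] := by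
    simp [ha, hb]
  have hy' : (φ (a * b)⁻¹ : Matrix (Fin 2) (Fin 2) ℤ) = !![1, -1; 1, 0] := by
    rw [map_inv, Matrix.coe_units_inv, hy, Matrix.inv_def]
    simp [Matrix.adjugate_fin_two]
  have hx : (φ (a * b * a) : Matrix (Fin 2) (Fin 2) ℤ) = !![0, 1; -1, 0] := by
    rw [map_mul, Units.val_mul, hy, ha]
    simp
  have hz : φ ((a * b) ^ 3) ∈ (GeneralLinearGroup.scalar (R := ℤ) (Fin 2)).range := by
    refine ⟨-1, Units.ext ?_⟩
    rw [← mul_mul_sq_eq_mul_pow_three h, map_mul, Units.val_mul, hx]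
    ext i j; fin_cases i <;> fin_cases j <;> simp [GeneralLinearGroup.scalar]
  obtain ⟨k, u, w, v, hu, hw, hv, rfl⟩ := HasBraidNormalForm.of_closure_eq_top h hab g
  rw [map_mul, map_zpow, Subgroup.mul_mem_cancel_left _ (Subgroup.zpow_mem _ hz k)] at hg
  obtain ⟨c, hc⟩ := hg
  have hc' : (φ u : Matrix (Fin 2) (Fin 2) ℤ) * φ w * φ v = Matrix.scalar (Fin 2) (c : ℤ) := by
    rw [← GeneralLinearGroup.coe_scalar, hc]
    simp
  obtain ⟨p, q, r, s, hφ, hp, hq, hr, hs, hw1⟩ := sign_pattern_of_mem_closure φ ha hb hw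
  rw [hφ] at hc'
  have h01 := congrFun₂ hc' 0 1
  have h10 := congrFun₂ hc' 1 0
  rcases hu with rfl | rfl | rfl <;> rcases hv with rfl | rfl <;>
    simp only [map_one, Units.val_one, one_mul, mul_one, hx, hy, hy',
      Matrix.scalar_apply, Matrix.diagonal] at h01 h10 <;>
    simp [Matrix.mul_apply, Fin.sum_univ_two] at h01 h10 <;>
    try lia
  obtain rfl : w = 1 := by lia
  simp

end BraidPair

lemma σ₁_mul_σ₂_mul_σ₁ : σ₁ * σ₂ * σ₁ = σ₂ * σ₁ * σ₂ := by
  rw [← mul_inv_eq_one]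
  exact PresentedGroup.one_of_mem (rels := braidRel) rfl

lemma closure_σ₁_σ₂ : Subgroup.closure {σ₁, σ₂} = (⊤ : Subgroup B3) := by
  rw [← PresentedGroup.closure_range_of braidRel]
  congr 1
  ext g
  simp [σ₁, σ₂, Fin.exists_fin_two, eq_comm]

/-- **Kernel of the projectivized Burau representation.** For β ∈ B₃, the matrix ρ₃(β)
is a scalar matrix u·Id (u a unit of ℤ[t,t⁻¹]) if and only if β is an integer power of
(σ₁σ₂)³.  Consequently, the kernel of the projectivized Burau representation
ρ̂₃ : B₃ → GL(2, ℤ[t,t⁻¹])/{±tⁿ·Id} — i.e. the set of β with ρ₃(β) = ±tⁿ·Id — is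
exactly the cyclic subgroup generated by (σ₁σ₂)³ (the center of B₃). -/
theorem burau_scalar_iff_central_power (ρ : B3 →* GL (Fin 2) Laur)
    (hρ₁ : (ρ σ₁ : Matrix (Fin 2) (Fin 2) Laur) = !![-T 1, 1; 0, 1])
    (hρ₂ : (ρ σ₂ : Matrix (Fin 2) (Fin 2) Laur) = !![1, 0; T 1, -T 1])
    (β : B3) :
    ((∃ u : Laurˣ, (ρ β : Matrix (Fin 2) (Fin 2) Laur) =
        (u : Laur) • (1 : Matrix (Fin 2) (Fin 2) Laur)) ↔
      ∃ k : ℤ, β = ((σ₁ * σ₂) ^ 3) ^ k) ∧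
    ((∃ n : ℤ,
        (ρ β : Matrix (Fin 2) (Fin 2) Laur) =
            (T n : Laur) • (1 : Matrix (Fin 2) (Fin 2) Laur) ∨
          (ρ β : Matrix (Fin 2) (Fin 2) Laur) =
            -((T n : Laur) • (1 : Matrix (Fin 2) (Fin 2) Laur))) ↔
      β ∈ Subgroup.zpowers ((σ₁ * σ₂) ^ 3)) := by
  have hz : (ρ ((σ₁ * σ₂) ^ 3) : Matrix (Fin 2) (Fin 2) Laur) = Matrix.scalar (Fin 2) (T 3) := by
    have h3 : (T 3 : Laur) = T 1 * T 1 * T 1 := by rw [← T_add, ← T_add]; norm_num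
    simp only [map_pow, map_mul, Units.val_pow_eq_pow_val, Units.val_mul, hρ₁, hρ₂, h3]
    generalize (T 1 : Laur) = τ
    ext1 i j
    fin_cases i <;> fin_cases j <;> simp [pow_succ]
  let t : ℤ → Laurˣ := fun n ↦ ⟨T n, T (-n), by rw [← T_add, add_neg_cancel, T_zero],
    by rw [← T_add, neg_add_cancel, T_zero]⟩
  have hzk (k : ℤ) : (ρ (((σ₁ * σ₂) ^ 3) ^ k) : Matrix (Fin 2) (Fin 2) Laur) =
      (T (3 * k) : Laur) • (1 : Matrix (Fin 2) (Fin 2) Laur) := by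
    have h1 : ρ ((σ₁ * σ₂) ^ 3) = GeneralLinearGroup.scalar (Fin 2) (t 3) := Units.ext hz
    have h2 : t 3 ^ k = t (3 * k) := by
      induction k with
      | zero => ext1; simp [t]
      | succ n ih =>
        rw [_root_.zpow_add_one, ih]
        ext1
        change T _ * T _ = (T _ : Laur)
        rw [← T_add, mul_add, mul_one]
      | pred n ih =>
        rw [_root_.zpow_sub_one, ih]
        ext1
        change T _ * T _ = (T _ : Laur)
        rw [← T_add]
        congr 1
        ring
    rw [map_zpow, h1, ← map_zpow, h2, GeneralLinearGroup.coe_scalar, Matrix.smul_one_eq_diagonal]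
    rfl
  have key (u : Laurˣ) (hu : (ρ β : Matrix (Fin 2) (Fin 2) Laur) =
      (u : Laur) • (1 : Matrix (Fin 2) (Fin 2) Laur)) :
      β ∈ Subgroup.zpowers ((σ₁ * σ₂) ^ 3) := by
    let ev : Laur →+* ℤ := LaurentPolynomial.eval₂ (RingHom.id ℤ) (-1)
    have hev : ev (T 1) = -1 := by
      simp only [ev, LaurentPolynomial.eval₂_T, zpow_one, Units.val_neg, Units.val_one]
    refine mem_zpowers_of_map_mem_range_scalar σ₁_mul_σ₂_mul_σ₁ closure_σ₁_σ₂
      ((GeneralLinearGroup.map ev).comp ρ) ?_ ?_ ⟨Units.map ev u, ?_⟩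
    · ext i j
      fin_cases i <;> fin_cases j <;> simp [hρ₁, hev]
    · ext i j
      fin_cases i <;> fin_cases j <;> simp [hρ₂, hev]
    · rw [← GeneralLinearGroup.map_scalar, MonoidHom.comp_apply]
      congr 1
      ext1
      rw [hu, GeneralLinearGroup.coe_scalar, Matrix.smul_one_eq_diagonal]
      rfl
  refine ⟨⟨fun ⟨u, hu⟩ ↦ ?_, ?_⟩, ⟨?_, ?_⟩⟩
  · obtain ⟨k, hk⟩ := key u hu
    exact ⟨k, hk.symm⟩
  · rintro ⟨k, rfl⟩
    exact ⟨t (3 * k), hzk k⟩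
  · rintro ⟨n, hn | hn⟩
    · exact key (t n) hn
    · refine key (-t n) ?_
      rw [hn, Units.val_neg, neg_smul]
  · rintro ⟨k, rfl⟩
    exact ⟨3 * k, .inl (hzk k)⟩
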